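/- arXiv:1007.5447 — 3 statements merged into one kernel-verified Lean document; each statement's English description precedes it below -/
import Mathlib

section
/- Let 1 ≤ M ≤ N be integers, λ > 0, E ∈ [0,1], n ≥ 1 an integer, and 0 = t_0 < t_1 < ⋯ < t_n = τ real numbers with T_i = t_i − t_{i−1}. Then (1/τ) · ∑_{i=1}^{n} ∫_{t_{i−1}}^{t_i} (1 − ∑_{x=M}^{N} S(M,N,x) · e^{xEλt_{i−1}} · e^{−xλt}) dt = 1 − ∑_{x=M}^{N} S(M,N,x) · ∑_{i=1}^{n} e^{−x(1−E)λt_{i−1}} · (1 − e^{−xλT_i}) / (xλτ). -/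
/-- The coefficient `S(M,N,x) = ∑_{k=M}^{x} C(N,x) · C(x,k) · (−1)^{x−k}`. -/
noncomputable def S (M N x : ℕ) : ℝ :=
  ∑ k ∈ Finset.Icc M x, (N.choose x : ℝ) * (x.choose k : ℝ) * (-1 : ℝ) ^ (x - k)

theorem integral_exp_neg_mul {c : ℝ} (hc : c ≠ 0) (a b : ℝ) :
    ∫ u in a..b, Real.exp (-(c * u)) = (Real.exp (-(c * a)) - Real.exp (-(c * b))) / c := by
  have h : ∀ u ∈ Set.uIcc a b,
      HasDerivAt (fun v => -Real.exp (-(c * v)) / c) (Real.exp (-(c * u))) u := fun u _ => by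
    refine ((((hasDerivAt_id' u).const_mul c).fun_neg.exp.fun_neg).div_const c).congr_deriv ?_
    field_simp
  rw [intervalIntegral.integral_eq_sub_of_hasDerivAt h
    (Continuous.intervalIntegrable (by fun_prop) _ _)]
  ring

theorem integral_one_sub_sum_exp (s : Finset ℕ) (hs : ∀ x ∈ s, x ≠ 0) (w : ℕ → ℝ)
    {lam : ℝ} (hlam : lam ≠ 0) (E a b : ℝ) :
    ∫ u in a..b, (1 - ∑ x ∈ s,
        w x * Real.exp ((x : ℝ) * E * lam * a) * Real.exp (-((x : ℝ) * lam * u)))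
      = (b - a) - ∑ x ∈ s, w x * (Real.exp (-((x : ℝ) * (1 - E) * lam * a)) *
          (1 - Real.exp (-((x : ℝ) * lam * (b - a)))) / ((x : ℝ) * lam)) := by
  rw [intervalIntegral.integral_sub (Continuous.intervalIntegrable (by fun_prop) _ _)
    (Continuous.intervalIntegrable (by fun_prop) _ _), intervalIntegral.integral_finsetSum
    (fun x _ => Continuous.intervalIntegrable (by fun_prop) _ _)]
  congr 1
  · simp
  · refine Finset.sum_congr rfl fun x hx => ?_
    have hc : (x : ℝ) * lam ≠ 0 := mul_ne_zero (Nat.cast_ne_zero.mpr (hs x hx)) hlam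
    rw [intervalIntegral.integral_const_mul, integral_exp_neg_mul hc, mul_assoc, ← mul_div_assoc,
      mul_sub, mul_sub, mul_one, ← Real.exp_add, ← Real.exp_add, ← Real.exp_add]
    ring_nf

theorem sum_Icc_one_sub_pred (t : ℕ → ℝ) (n : ℕ) :
    ∑ i ∈ Finset.Icc 1 n, (t i - t (i - 1)) = t n - t 0 := by
  induction n with
  | zero => simp
  | succ n ih =>
    rw [Finset.sum_Icc_succ_top (by omega), ih]
    simp

theorem stmt_7 (M N : ℕ) (hM : 1 ≤ M) (hMN : M ≤ N)
    (lam E : ℝ) (hlam : 0 < lam) (hE0 : 0 ≤ E) (hE1 : E ≤ 1)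
    (n : ℕ) (hn : 1 ≤ n) (t : ℕ → ℝ) (ht0 : t 0 = 0)
    (hmono : ∀ i < n, t i < t (i + 1)) :
    (1 / t n) *
        ∑ i ∈ Finset.Icc 1 n,
          ∫ u in (t (i - 1))..(t i),
            (1 - ∑ x ∈ Finset.Icc M N,
              S M N x * Real.exp ((x : ℝ) * E * lam * t (i - 1)) *
                Real.exp (-((x : ℝ) * lam * u)))
      = 1 - ∑ x ∈ Finset.Icc M N,
          S M N x *
            ∑ i ∈ Finset.Icc 1 n,
              Real.exp (-((x : ℝ) * (1 - E) * lam * t (i - 1))) *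
                (1 - Real.exp (-((x : ℝ) * lam * (t i - t (i - 1))))) /
                  ((x : ℝ) * lam * t n) := by
  have hpos : 0 < t n := by
    have htel := sum_Icc_one_sub_pred t n
    rw [ht0, sub_zero] at htel
    rw [← htel]
    refine Finset.sum_pos (fun i hi => ?_) ⟨1, Finset.mem_Icc.mpr ⟨le_rfl, hn⟩⟩
    obtain ⟨h1, h2⟩ := Finset.mem_Icc.mp hi
    have h := hmono (i - 1) (by omega)
    rw [Nat.sub_add_cancel h1] at h
    exact sub_pos.mpr h
  have hs : ∀ x ∈ Finset.Icc M N, x ≠ 0 := fun x hx => by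
    have := (Finset.mem_Icc.mp hx).1
    omega
  simp_rw [integral_one_sub_sum_exp _ hs _ hlam.ne']
  rw [Finset.sum_sub_distrib, sum_Icc_one_sub_pred, ht0, sub_zero, mul_sub,
    one_div_mul_cancel hpos.ne', Finset.sum_comm, Finset.mul_sum]
  congr 1
  refine Finset.sum_congr rfl fun x _ => ?_
  rw [← Finset.mul_sum, mul_left_comm, Finset.mul_sum]
  congr 1
  refine Finset.sum_congr rfl fun i _ => ?_
  rw [one_div_mul_eq_div, div_div]
end

section
/- Let 1 ≤ M ≤ N be integers, E ∈ [0,1], and 0 ≤ s ≤ t fixed real numbers. For λ > 0 define U(λ) = 1 − ∑_{x=M}^{N} S(M,N,x) · e^{xEλs} · e^{−xλt}. Then, as λ → 0⁺, U(λ) / λ^{N−M+1} tends to C(N, M−1) · (t − E·s)^{N−M+1}. -/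
/-- Binomial expansion of `p ^ k * (1 - p) ^ (N - k)`, weighted by `N.choose k`. -/
lemma sum_Icc_choose_mul_choose_neg_one_pow {N k : ℕ} (hk : k ≤ N) (p : ℝ) :
    ∑ x ∈ Finset.Icc k N, (N.choose x : ℝ) * (x.choose k : ℝ) * (-1 : ℝ) ^ (x - k) * p ^ x
      = (N.choose k : ℝ) * p ^ k * (1 - p) ^ (N - k) := by
  obtain ⟨d, rfl⟩ := Nat.exists_eq_add_of_le hk
  rw [← Finset.Ico_add_one_right_eq_Icc, Finset.sum_Ico_eq_sum_range,
    show k + d + 1 - k = d + 1 by lia, show k + d - k = d by lia,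
    show (1 - p) = -p + 1 by ring, add_pow, Finset.mul_sum]
  refine Finset.sum_congr rfl fun j _ => ?_
  have h : (k + d).choose (k + j) * (k + j).choose k = (k + d).choose k * d.choose j := by
    rw [Nat.choose_mul (Nat.le_add_right k j)]
    simp
  have h' : ((k + d).choose (k + j) : ℝ) * ((k + j).choose k : ℝ)
      = ((k + d).choose k : ℝ) * (d.choose j : ℝ) := by exact_mod_cast h
  rw [h', Nat.add_sub_cancel_left, neg_pow p, pow_add, one_pow]
  ring

/-- The `S`-weighted sum of powers of `p` is an upper binomial tail, so its complement is the
lower tail. -/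
lemma one_sub_sum_S_mul_pow {M N : ℕ} (hMN : M ≤ N) (p : ℝ) :
    1 - ∑ x ∈ Finset.Icc M N, S M N x * p ^ x
      = ∑ k ∈ Finset.range M, (N.choose k : ℝ) * p ^ k * (1 - p) ^ (N - k) := by
  have htail : ∑ x ∈ Finset.Icc M N, S M N x * p ^ x
      = ∑ k ∈ Finset.Ico M (N + 1), (N.choose k : ℝ) * p ^ k * (1 - p) ^ (N - k) := by
    simp only [S, Finset.sum_mul]
    rw [Finset.sum_comm' (t' := Finset.Ico M (N + 1)) (s' := fun k => Finset.Icc k N)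
      (by intro x k; simp only [Finset.mem_Icc, Finset.mem_Ico]; lia)]
    refine Finset.sum_congr rfl fun k hk => ?_
    exact sum_Icc_choose_mul_choose_neg_one_pow
      (Nat.lt_succ_iff.mp (Finset.mem_Ico.mp hk).2) p
  have hall : ∑ k ∈ Finset.range (N + 1), (N.choose k : ℝ) * p ^ k * (1 - p) ^ (N - k) = 1 := by
    have h := add_pow p (1 - p) N
    rw [add_sub_cancel, one_pow] at h
    refine Eq.trans (Finset.sum_congr rfl fun k _ => ?_) h.symm
    ring
  rw [← Finset.sum_range_add_sum_Ico _ (show M ≤ N + 1 by lia)] at hall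
  rw [htail]
  linarith

lemma tendsto_one_sub_exp_neg_mul_div (a : ℝ) :
    Filter.Tendsto (fun l : ℝ => (1 - Real.exp (-(a * l))) / l)
      (nhdsWithin 0 (Set.Ioi 0)) (nhds a) := by
  have h : HasDerivAt (fun l : ℝ => 1 - Real.exp (-(a * l))) a 0 := by
    have h := (((hasDerivAt_id (0 : ℝ)).const_mul a).neg.exp).const_sub 1
    simpa using h
  have h' := h.tendsto_slope_zero_right
  simpa [div_eq_inv_mul] using h'

theorem stmt_9 (M N : ℕ) (hM : 1 ≤ M) (hMN : M ≤ N)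
    (E s t : ℝ) (hE0 : 0 ≤ E) (hE1 : E ≤ 1) (hs : 0 ≤ s) (hst : s ≤ t) :
    Filter.Tendsto
      (fun lam : ℝ =>
        (1 - ∑ x ∈ Finset.Icc M N,
          S M N x * Real.exp ((x : ℝ) * E * lam * s) * Real.exp (-((x : ℝ) * lam * t)))
          / lam ^ (N - M + 1))
      (nhdsWithin 0 (Set.Ioi 0))
      (nhds ((N.choose (M - 1) : ℝ) * (t - E * s) ^ (N - M + 1))) := by
  set a := t - E * s with ha
  have hp : Filter.Tendsto (fun l : ℝ => Real.exp (-(a * l)))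
      (nhdsWithin 0 (Set.Ioi 0)) (nhds 1) := by
    have hc : Continuous fun l : ℝ => Real.exp (-(a * l)) := by fun_prop
    simpa using (hc.tendsto 0).mono_left nhdsWithin_le_nhds
  have hid : Filter.Tendsto (fun l : ℝ => l) (nhdsWithin 0 (Set.Ioi 0)) (nhds 0) :=
    Filter.tendsto_id.mono_left nhdsWithin_le_nhds
  have hlim : Filter.Tendsto
      (fun l : ℝ => ∑ k ∈ Finset.range M, (N.choose k : ℝ) * Real.exp (-(a * l)) ^ k
        * ((1 - Real.exp (-(a * l))) / l) ^ (N - k) * l ^ (M - 1 - k))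
      (nhdsWithin 0 (Set.Ioi 0))
      (nhds (∑ k ∈ Finset.range M,
        (N.choose k : ℝ) * 1 ^ k * a ^ (N - k) * 0 ^ (M - 1 - k))) :=
    tendsto_finsetSum _ fun k _ =>
      (((hp.pow k).const_mul _).mul ((tendsto_one_sub_exp_neg_mul_div a).pow _)).mul (hid.pow _)
  have hval : ∑ k ∈ Finset.range M, (N.choose k : ℝ) * 1 ^ k * a ^ (N - k) * 0 ^ (M - 1 - k)
      = (N.choose (M - 1) : ℝ) * a ^ (N - M + 1) := by
    rw [Finset.sum_eq_single_of_mem (M - 1) (Finset.mem_range.mpr (by lia))]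
    · simp [show N - (M - 1) = N - M + 1 by lia]
    · intro k hk hne
      rw [Finset.mem_range] at hk
      rw [zero_pow (by lia), mul_zero]
  rw [hval] at hlim
  refine hlim.congr' ?_
  filter_upwards [self_mem_nhdsWithin] with l hl
  have hl0 : l ≠ 0 := ne_of_gt hl
  have hsum : ∑ x ∈ Finset.Icc M N,
        S M N x * Real.exp ((x : ℝ) * E * l * s) * Real.exp (-((x : ℝ) * l * t))
      = ∑ x ∈ Finset.Icc M N, S M N x * Real.exp (-(a * l)) ^ x := by
    refine Finset.sum_congr rfl fun x _ => ?_
    rw [mul_assoc, ← Real.exp_add, ← Real.exp_nat_mul, ha]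
    ring_nf
  rw [hsum, one_sub_sum_S_mul_pow hMN, Finset.sum_div]
  refine Finset.sum_congr rfl fun k hk => ?_
  rw [Finset.mem_range] at hk
  rw [div_pow, show N - k = (N - M + 1) + (M - 1 - k) by lia, pow_add l]
  field_simp
end

section
/- Let n ≥ 2 be an integer, λ > 0, E ∈ (0,1], and 0 = t_0 < t_1 < ⋯ < t_n = τ real numbers with T_i = t_i − t_{i−1}. Define Obs_i = E·λ·T_i for i = 1, …, n−1 and Obs_n = E·λ·T_n + (1−E)·λ·τ. Then the partial-test-efficiency estimator is exact: (τ / t_{n−1}) · (∑_{i=1}^{n−1} Obs_i) / (∑_{i=1}^{n} Obs_i) = E. -/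
/-- A telescoping sum over `Finset.Icc 1 m` with a constant factor. -/
theorem sum_Icc_one_mul_sub (c : ℝ) (t : ℕ → ℝ) (m : ℕ) :
    ∑ i ∈ Finset.Icc 1 m, c * (t i - t (i - 1)) = c * (t m - t 0) := by
  induction m with
  | zero => simp
  | succ k ih =>
    rw [Finset.sum_Icc_succ_top (by omega), ih, Nat.add_sub_cancel]
    ring

theorem stmt_14 (n : ℕ) (hn : 2 ≤ n)
    (lam E : ℝ) (hlam : 0 < lam) (hE0 : 0 < E) (hE1 : E ≤ 1)
    (t : ℕ → ℝ) (ht0 : t 0 = 0) (hmono : ∀ i < n, t i < t (i + 1)) :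
    (t n / t (n - 1)) *
        ((∑ i ∈ Finset.Icc 1 (n - 1), E * lam * (t i - t (i - 1))) /
          ∑ i ∈ Finset.Icc 1 n,
            (if i = n then E * lam * (t n - t (n - 1)) + (1 - E) * lam * t n
             else E * lam * (t i - t (i - 1))))
      = E := by
  have hpos : ∀ m, m + 1 ≤ n → 0 < t (m + 1) := by
    intro m
    induction m with
    | zero => intro h; simpa [ht0] using hmono 0 h
    | succ k ih => intro h; exact (ih (by omega)).trans (hmono (k + 1) h)
  obtain ⟨m, rfl⟩ : ∃ m, n = m + 2 := ⟨n - 2, by omega⟩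
  have hprev : t (m + 1) ≠ 0 := (hpos m (by omega)).ne'
  have hlast : t (m + 2) ≠ 0 := (hpos (m + 1) le_rfl).ne'
  have hsum : ∑ i ∈ Finset.Icc 1 (m + 1),
      (if i = m + 2 then E * lam * (t (m + 2) - t (m + 1)) + (1 - E) * lam * t (m + 2)
        else E * lam * (t i - t (i - 1))) = E * lam * t (m + 1) := by
    rw [Finset.sum_congr rfl fun i hi => if_neg (by have := Finset.mem_Icc.mp hi; omega),
      sum_Icc_one_mul_sub, ht0, sub_zero]
  have htotal : E * lam * t (m + 1) +
      (E * lam * (t (m + 2) - t (m + 1)) + (1 - E) * lam * t (m + 2)) = lam * t (m + 2) := by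
    ring
  rw [show m + 2 - 1 = m + 1 from rfl, sum_Icc_one_mul_sub, ht0, sub_zero,
    Finset.sum_Icc_succ_top (by omega), if_pos rfl, hsum, htotal]
  field_simp
end
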